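/- Let k > 0, let δ, β, δ̃, β̃ : ℝ² → ℝ be integrable with compact support, and let V ⊆ ℝ be a nonempty open set of angles. Assume the non-phase-wrapping conditions 0 ≤ k·Rδ(θ, s) < 2π and 0 ≤ k·Rδ̃(θ, s) < 2π for all θ ∈ ℝ and almost every s ∈ ℝ. If the object transmission data agree, i.e. exp(−i·k·(Rδ(θ, s) − i·Rβ(θ, s))) = exp(−i·k·(Rδ̃(θ, s) − i·Rβ̃(θ, s))) for every θ ∈ V and almost every s ∈ ℝ, then δ = δ̃ and β = β̃ almost everywhere on ℝ². -/

import Mathlib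

open MeasureTheory

/-- The Radon transform of `f : ℝ² → ℝ`: the integral of `f` along the line with unit
normal `(cos θ, sin θ)` at signed distance `s` from the origin, i.e. along
`t ↦ s·(cos θ, sin θ) + t·(−sin θ, cos θ)`. -/
noncomputable def radonTransform (f : ℝ × ℝ → ℝ) (θ s : ℝ) : ℝ :=
  ∫ t : ℝ, f (s * Real.cos θ - t * Real.sin θ, s * Real.sin θ + t * Real.cos θ)

lemma rot_mp (θ : ℝ) : MeasurePreserving
    (fun p : ℝ × ℝ => (p.1 * Real.cos θ - p.2 * Real.sin θ, p.1 * Real.sin θ + p.2 * Real.cos θ))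
    volume volume := by
  refine ⟨by fun_prop, ?_⟩
  let L : ℝ × ℝ →ₗ[ℝ] ℝ × ℝ := Matrix.toLin (Module.Basis.finTwoProd ℝ) (Module.Basis.finTwoProd ℝ)
    !![Real.cos θ, - Real.sin θ; Real.sin θ, Real.cos θ]
  have hd : LinearMap.det L = 1 := by
    simp only [L, LinearMap.det_toLin, Matrix.det_fin_two_of]
    nlinarith [Real.sin_sq_add_cos_sq θ]
  have h := Measure.map_linearMap_addHaar_eq_smul_addHaar (volume : Measure (ℝ × ℝ)) (f := L)
    (by rw [hd]; exact one_ne_zero)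
  rw [hd] at h
  have hL : (fun p : ℝ × ℝ => (p.1 * Real.cos θ - p.2 * Real.sin θ,
      p.1 * Real.sin θ + p.2 * Real.cos θ)) = L := by
    funext p
    simp only [L, Matrix.toLin_finTwoProd_apply]
    ext <;> simp <;> ring
  rw [hL, h]
  simp

lemma integrable_rot {f : ℝ × ℝ → ℝ} (hf : Integrable f) (θ : ℝ) :
    Integrable (fun p : ℝ × ℝ => f (p.1 * Real.cos θ - p.2 * Real.sin θ,
      p.1 * Real.sin θ + p.2 * Real.cos θ)) :=
  (rot_mp θ).integrable_comp_of_integrable hf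

lemma radon_sub {f g : ℝ × ℝ → ℝ} (hf : Integrable f) (hg : Integrable g) (θ : ℝ) :
    ∀ᵐ s : ℝ, radonTransform (f - g) θ s = radonTransform f θ s - radonTransform g θ s := by
  have h1 := (integrable_rot hf θ)
  have h2 := (integrable_rot hg θ)
  rw [Measure.volume_eq_prod] at h1 h2
  filter_upwards [h1.prod_right_ae, h2.prod_right_ae] with s hs1 hs2
  exact integral_sub hs1 hs2

/-- Fourier slice. -/
lemma slice {f : ℝ × ℝ → ℝ} (hf : Integrable f) (θ r : ℝ)
    (h : ∀ᵐ s : ℝ, radonTransform f θ s = 0) :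
    ∫ p : ℝ × ℝ, (f p : ℂ) * Complex.exp (Complex.I * r * (p.1 * Real.cos θ + p.2 * Real.sin θ))
      = 0 := by
  have hG : Integrable (fun p : ℝ × ℝ => (f p : ℂ) *
      Complex.exp (Complex.I * r * (p.1 * Real.cos θ + p.2 * Real.sin θ))) := by
    refine hf.ofReal.mul_bdd (c := 1) (Continuous.aestronglyMeasurable (by fun_prop)) (Filter.Eventually.of_forall fun p => ?_)
    rw [Complex.norm_exp]
    simp
  have hm := rot_mp θ
  have hG' := hm.integrable_comp_of_integrable hG
  have e : ∫ p : ℝ × ℝ, (f p : ℂ) *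
      Complex.exp (Complex.I * r * (p.1 * Real.cos θ + p.2 * Real.sin θ)) =
      ∫ p : ℝ × ℝ, ((fun p : ℝ × ℝ => (f p : ℂ) *
      Complex.exp (Complex.I * r * (p.1 * Real.cos θ + p.2 * Real.sin θ))) ∘
      (fun p : ℝ × ℝ => (p.1 * Real.cos θ - p.2 * Real.sin θ,
        p.1 * Real.sin θ + p.2 * Real.cos θ))) p := by
    conv_lhs => rw [← hm.map_eq]
    rw [integral_map hm.measurable.aemeasurable (by rw [hm.map_eq]; exact hG.aestronglyMeasurable)]
    rfl
  rw [e]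
  rw [Measure.volume_eq_prod] at hG' ⊢
  rw [integral_prod _ hG']
  apply integral_eq_zero_of_ae
  filter_upwards [h] with s hs
  have : ∀ t : ℝ, ((fun p : ℝ × ℝ => (f p : ℂ) *
      Complex.exp (Complex.I * r * (p.1 * Real.cos θ + p.2 * Real.sin θ))) ∘
      (fun p : ℝ × ℝ => (p.1 * Real.cos θ - p.2 * Real.sin θ,
        p.1 * Real.sin θ + p.2 * Real.cos θ))) (s, t) =
      (f (s * Real.cos θ - t * Real.sin θ, s * Real.sin θ + t * Real.cos θ) : ℂ) *
        Complex.exp (Complex.I * r * s) := by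
    intro t
    simp only [Function.comp]
    congr 2
    have hsc : (Complex.sin θ) ^ 2 + (Complex.cos θ) ^ 2 = 1 := Complex.sin_sq_add_cos_sq _
    push_cast
    linear_combination (Complex.I * r * s) * hsc
  simp only [this]
  rw [integral_mul_const, integral_complex_ofReal]
  unfold radonTransform at hs
  rw [hs]; simp

lemma entire {f : ℝ × ℝ → ℝ} (hf : Integrable f) (hc : HasCompactSupport f) (r : ℝ) :
    Differentiable ℂ (fun z : ℂ => ∫ p : ℝ × ℝ, (f p : ℂ) *
      Complex.exp (Complex.I * r * (p.1 * Complex.cos z + p.2 * Complex.sin z))) := by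
  intro z₀
  let H : ℂ × (ℝ × ℝ) → ℂ := fun q =>
    Complex.exp (Complex.I * r * (q.2.1 * Complex.cos q.1 + q.2.2 * Complex.sin q.1)) *
      (Complex.I * r * (q.2.1 * -Complex.sin q.1 + q.2.2 * Complex.cos q.1))
  have hH : Continuous H := by fun_prop
  obtain ⟨C, hC⟩ := ((isCompact_closedBall z₀ 1).prod hc.isCompact).exists_bound_of_continuousOn
    hH.continuousOn
  obtain ⟨C', hC'⟩ := hc.isCompact.exists_bound_of_continuousOn
    (f := fun p : ℝ × ℝ =>
      Complex.exp (Complex.I * r * (p.1 * Complex.cos z₀ + p.2 * Complex.sin z₀)))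
    (by fun_prop)
  have hfm : AEStronglyMeasurable (fun p => (f p : ℂ)) volume := hf.ofReal.aestronglyMeasurable
  refine (hasDerivAt_integral_of_dominated_loc_of_deriv_le (s := Metric.ball z₀ 1)
    (F' := fun z p => (f p : ℂ) * H (z, p)) (bound := fun p => ‖f p‖ * C)
    (Metric.ball_mem_nhds _ one_pos) ?_ ?_ ?_ ?_ ?_ ?_).2.differentiableAt
  · refine Filter.Eventually.of_forall fun z => hfm.mul ?_
    exact Continuous.aestronglyMeasurable (by fun_prop)
  · refine (hf.norm.mul_const C').mono' (hfm.mul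
      (Continuous.aestronglyMeasurable (by fun_prop))) (Filter.Eventually.of_forall fun p => ?_)
    by_cases hp : p ∈ tsupport f
    · rw [norm_mul, Complex.norm_real]
      exact mul_le_mul_of_nonneg_left (hC' p hp) (norm_nonneg _)
    · simp [image_eq_zero_of_notMem_tsupport hp]
  · exact hfm.mul (Continuous.aestronglyMeasurable (by fun_prop))
  · refine Filter.Eventually.of_forall fun p z hz => ?_
    by_cases hp : p ∈ tsupport f
    · rw [norm_mul, Complex.norm_real]
      exact mul_le_mul_of_nonneg_left (hC (z, p) ⟨Metric.ball_subset_closedBall hz, hp⟩)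
        (norm_nonneg _)
    · simp [image_eq_zero_of_notMem_tsupport hp]
  · exact hf.norm.mul_const C
  · refine Filter.Eventually.of_forall fun p z hz => ?_
    refine HasDerivAt.const_mul _ (HasDerivAt.cexp ?_)
    exact (((Complex.hasDerivAt_cos z).const_mul _).add
      ((Complex.hasDerivAt_sin z).const_mul _)).const_mul _

lemma fourier_radon_zero {f : ℝ × ℝ → ℝ} (hf : Integrable f) (hc : HasCompactSupport f)
    {V : Set ℝ} (hV : IsOpen V) (hVne : V.Nonempty)
    (h : ∀ θ ∈ V, ∀ᵐ s : ℝ, radonTransform f θ s = 0) (r θ : ℝ) :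
    ∫ p : ℝ × ℝ, (f p : ℂ) * Complex.exp (Complex.I * r * (p.1 * Real.cos θ + p.2 * Real.sin θ))
      = 0 := by
  obtain ⟨θ₀, hθ₀⟩ := hVne
  have hA : AnalyticOnNhd ℂ (fun z : ℂ => ∫ p : ℝ × ℝ, (f p : ℂ) *
      Complex.exp (Complex.I * r * (p.1 * Complex.cos z + p.2 * Complex.sin z))) Set.univ :=
    fun z _ => (entire hf hc r).analyticAt z
  have hfr : ∃ᶠ z in nhdsWithin (θ₀ : ℂ) {(θ₀ : ℂ)}ᶜ, (∫ p : ℝ × ℝ, (f p : ℂ) *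
      Complex.exp (Complex.I * r * (p.1 * Complex.cos z + p.2 * Complex.sin z))) =
      (fun _ => (0 : ℂ)) z := by
    have ht : Filter.Tendsto (fun x : ℝ => (x : ℂ)) (nhdsWithin θ₀ {θ₀}ᶜ)
        (nhdsWithin (θ₀ : ℂ) {(θ₀ : ℂ)}ᶜ) := by
      refine tendsto_nhdsWithin_iff.2 ⟨Complex.continuous_ofReal.continuousAt.tendsto.mono_left
        nhdsWithin_le_nhds, ?_⟩
      filter_upwards [self_mem_nhdsWithin] with x hx
      simpa using hx
    refine ht.frequently (Filter.Eventually.frequently ?_)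
    filter_upwards [nhdsWithin_le_nhds (hV.mem_nhds hθ₀)] with x hx
    have := slice hf x r (h x hx)
    simpa using this
  have := congrFun (hA.eq_of_frequently_eq analyticOnNhd_const hfr) (θ : ℂ)
  simpa using this

lemma ae_zero_of_fourier {f : ℝ × ℝ → ℝ} (hf : Integrable f)
    (h : ∀ r θ : ℝ, ∫ p : ℝ × ℝ, (f p : ℂ) *
      Complex.exp (Complex.I * r * (p.1 * Real.cos θ + p.2 * Real.sin θ)) = 0) :
    f =ᵐ[volume] 0 := by
  have hfin1 : IsFiniteMeasure (volume.withDensity fun x => ENNReal.ofReal (f x)) :=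
    isFiniteMeasure_withDensity_ofReal hf.2
  have hfin2 : IsFiniteMeasure (volume.withDensity fun x => ENNReal.ofReal ((-f) x)) :=
    isFiniteMeasure_withDensity_ofReal hf.neg.2
  have m1 : AEMeasurable (fun x => ENNReal.ofReal (f x)) volume := hf.1.aemeasurable.ennreal_ofReal
  have m2 : AEMeasurable (fun x => ENNReal.ofReal ((-f) x)) volume :=
    hf.neg.1.aemeasurable.ennreal_ofReal
  have key : (volume.withDensity fun x => ENNReal.ofReal (f x)) =
      (volume.withDensity fun x => ENNReal.ofReal ((-f) x)) := by
    apply Measure.ext_of_charFunDual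
    funext L
    rw [charFunDual_apply, charFunDual_apply,
      integral_withDensity_eq_integral_toReal_smul₀ m1 (by simp),
      integral_withDensity_eq_integral_toReal_smul₀ m2 (by simp), ← sub_eq_zero]
    have bd : ∀ p : ℝ × ℝ, ‖Complex.exp (L p * Complex.I)‖ ≤ 1 := fun p =>
      (Complex.norm_exp_ofReal_mul_I _).le
    have hb : ∀ g : ℝ × ℝ → ℝ, Integrable g → Integrable (fun p =>
        (ENNReal.ofReal (g p)).toReal • Complex.exp (L p * Complex.I)) := by
      intro g hg
      have : Integrable (fun p => (ENNReal.ofReal (g p)).toReal) := by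
        simpa [ENNReal.toReal_ofReal'] using hg.pos_part
      have := (this.ofReal (𝕜 := ℂ)).mul_bdd (g := fun p => Complex.exp (L p * Complex.I)) (c := 1)
        (Continuous.aestronglyMeasurable (by fun_prop)) (Filter.Eventually.of_forall bd)
      simpa using this
    rw [← integral_sub (hb _ hf) (hb _ hf.neg)]
    set w : ℂ := ⟨L (1, 0), L (0, 1)⟩ with hw
    rw [← h ‖w‖ w.arg]
    congr 1
    funext p
    have h1 : ‖w‖ * Real.cos w.arg = L (1, 0) := Complex.norm_mul_cos_arg w
    have h2 : ‖w‖ * Real.sin w.arg = L (0, 1) := Complex.norm_mul_sin_arg w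
    have hL : L p = p.1 * L (1, 0) + p.2 * L (0, 1) := by
      have : p = p.1 • ((1 : ℝ), (0 : ℝ)) + p.2 • ((0 : ℝ), (1 : ℝ)) := by ext <;> simp
      conv_lhs => rw [this]
      rw [map_add, map_smul, map_smul]; simp
    have e1 : (L p : ℂ) * Complex.I = Complex.I * (‖w‖ : ℝ) *
        (p.1 * (Real.cos w.arg : ℝ) + p.2 * (Real.sin w.arg : ℝ)) := by
      rw [hL, ← h1, ← h2]; push_cast; ring
    rw [e1, ← sub_smul, Complex.real_smul]
    congr 2
    simp only [ENNReal.toReal_ofReal', Pi.neg_apply]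
    exact max_zero_sub_eq_self (f p)
  rw [withDensity_eq_iff_of_sigmaFinite m1 m2] at key
  filter_upwards [key] with x hx
  have := congrArg ENNReal.toReal hx
  simp only [ENNReal.toReal_ofReal', Pi.neg_apply] at this
  have h3 := max_zero_sub_eq_self (f x)
  simp only [Pi.zero_apply]
  linarith

lemma radon_unique {f g : ℝ × ℝ → ℝ} (hf : Integrable f) (hfc : HasCompactSupport f)
    (hg : Integrable g) (hgc : HasCompactSupport g)
    {V : Set ℝ} (hV : IsOpen V) (hVne : V.Nonempty)
    (h : ∀ θ ∈ V, ∀ᵐ s : ℝ, radonTransform f θ s = radonTransform g θ s) : f =ᵐ[volume] g := by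
  have hz : f - g =ᵐ[volume] 0 := by
    refine ae_zero_of_fourier (hf.sub hg) fun r θ => ?_
    refine fourier_radon_zero (hf.sub hg) (hfc.sub hgc) hV hVne (fun θ hθ => ?_) r θ
    filter_upwards [radon_sub hf hg θ, h θ hθ] with s h1 h2
    rw [h1, h2, sub_self]
  filter_upwards [hz] with x hx
  exact sub_eq_zero.1 hx

lemma exp_inj {k a b a' b' : ℝ} (hk : 0 < k) (h1 : 0 ≤ k * a ∧ k * a < 2 * Real.pi)
    (h2 : 0 ≤ k * a' ∧ k * a' < 2 * Real.pi)
    (h : Complex.exp (-Complex.I * (k : ℂ) * ((a : ℂ) - Complex.I * (b : ℂ)))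
      = Complex.exp (-Complex.I * (k : ℂ) * ((a' : ℂ) - Complex.I * (b' : ℂ)))) :
    a = a' ∧ b = b' := by
  obtain ⟨n, hn⟩ := Complex.exp_eq_exp_iff_exists_int.1 h
  have hre := congrArg Complex.re hn
  have him := congrArg Complex.im hn
  simp at hre him
  have hpi := Real.pi_pos
  have n1 : (n : ℝ) < 1 := by
    by_contra hc
    push Not at hc
    nlinarith
  have n2 : (-1 : ℝ) < n := by
    by_contra hc
    push Not at hc
    nlinarith
  have n0 : n = 0 := by
    have : n < 1 := by exact_mod_cast n1
    have : -1 < n := by exact_mod_cast n2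
    omega
  subst n0
  simp at him
  constructor
  · rcases him with h | h
    · exact h
    · exact absurd h hk.ne'
  · rcases hre with h | h
    · exact h
    · exact absurd h hk.ne'

/-- **Uniqueness of phase contrast tomography modulo phase-wrapping — inversion step**
(proof of Corollary 2 of the paper): for non-phase-wrapping objects
(`0 ≤ k·Rδ < 2π`), equality of the object transmission functions
`exp(−ik·(Rδ − i·Rβ))` for all angles in a nonempty open set `V` and almost every
offset `s` forces `δ = δ̃` and `β = β̃` almost everywhere. -/
theorem phase_contrast_tomography_uniqueness
    (k : ℝ) (hk : 0 < k)
    (δ β δ' β' : ℝ × ℝ → ℝ)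
    (hδint : Integrable δ) (hδsupp : HasCompactSupport δ)
    (hβint : Integrable β) (hβsupp : HasCompactSupport β)
    (hδ'int : Integrable δ') (hδ'supp : HasCompactSupport δ')
    (hβ'int : Integrable β') (hβ'supp : HasCompactSupport β')
    (hwrap : ∀ θ : ℝ, ∀ᵐ s : ℝ,
      0 ≤ k * radonTransform δ θ s ∧ k * radonTransform δ θ s < 2 * Real.pi)
    (hwrap' : ∀ θ : ℝ, ∀ᵐ s : ℝ,
      0 ≤ k * radonTransform δ' θ s ∧ k * radonTransform δ' θ s < 2 * Real.pi)
    (V : Set ℝ) (hV : IsOpen V) (hVne : V.Nonempty)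
    (heq : ∀ θ ∈ V, ∀ᵐ s : ℝ,
      Complex.exp (-Complex.I * (k : ℂ) *
          ((radonTransform δ θ s : ℂ) - Complex.I * (radonTransform β θ s : ℂ)))
      = Complex.exp (-Complex.I * (k : ℂ) *
          ((radonTransform δ' θ s : ℂ) - Complex.I * (radonTransform β' θ s : ℂ)))) :
    δ =ᵐ[volume] δ' ∧ β =ᵐ[volume] β' := by
  have key : ∀ θ ∈ V, ∀ᵐ s : ℝ, radonTransform δ θ s = radonTransform δ' θ s ∧
      radonTransform β θ s = radonTransform β' θ s := by
    intro θ hθ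
    filter_upwards [hwrap θ, hwrap' θ, heq θ hθ] with s h1 h2 h3
    exact exp_inj hk h1 h2 h3
  exact ⟨radon_unique hδint hδsupp hδ'int hδ'supp hV hVne
      fun θ hθ => (key θ hθ).mono fun s hs => hs.1,
    radon_unique hβint hβsupp hβ'int hβ'supp hV hVne
      fun θ hθ => (key θ hθ).mono fun s hs => hs.2⟩
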